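/- The Fourier expansion of the modular j-function in the variable q = e^{2πiτ} has integer coefficients: j(τ) ∈ q^{−1} + Z[[q]], with j(τ) = q^{−1} + 744 + 196884 q + … . -/

import Mathlib

open UpperHalfPlane Complex

/-- The weight-`k` Eisenstein sum `Σ_{(c,d) ≠ (0,0)} ((cτ + d)^k)⁻¹` for the lattice
`ℤτ + ℤ`. -/
noncomputable def eisSum (k : ℕ) (τ : ℍ) : ℂ :=
  ∑' p : {p : ℤ × ℤ // p ≠ 0}, (((p.1.1 : ℂ) * τ + (p.1.2 : ℂ)) ^ k)⁻¹

noncomputable def gTwoH (τ : ℍ) : ℂ := 60 * eisSum 4 τ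

noncomputable def gThreeH (τ : ℍ) : ℂ := 140 * eisSum 6 τ

/-- The modular `j`-function `j(τ) = 1728 g₂³/(g₂³ - 27 g₃²)` of the lattice `ℤτ + ℤ`. -/
noncomputable def jFun (τ : ℍ) : ℂ :=
  1728 * gTwoH τ ^ 3 / (gTwoH τ ^ 3 - 27 * gThreeH τ ^ 2)

/-- The nome `q = e^{2πiτ}`. -/
noncomputable def nome (τ : ℍ) : ℂ := Complex.exp (2 * Real.pi * Complex.I * τ)

open ModularForm EisensteinSeries
open scoped ArithmeticFunction.sigma MatrixGroups

/-- The power series `P` converges on the open unit disc to the function `F`. -/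
def ConvergesOnDisc (P : PowerSeries ℂ) (F : ℂ → ℂ) : Prop :=
  ∀ q : ℂ, ‖q‖ < 1 → HasSum (fun n ↦ P.coeff n * q ^ n) (F q)

namespace ConvergesOnDisc

variable {P Q : PowerSeries ℂ} {F G : ℂ → ℂ}

lemma mul (hP : ConvergesOnDisc P F) (hQ : ConvergesOnDisc Q G) :
    ConvergesOnDisc (P * Q) (F * G) := by
  intro q hq
  have hp := hP q hq
  have hg := hQ q hq
  rw [Pi.mul_apply, ← hp.tsum_eq, ← hg.tsum_eq,
    tsum_mul_tsum_eq_tsum_sum_antidiagonal_of_summable_norm hp.summable.norm hg.summable.norm]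
  convert! (summable_norm_sum_mul_antidiagonal_of_summable_norm hp.summable.norm
    hg.summable.norm).of_norm.hasSum using 1
  ext n
  rw [PowerSeries.coeff_mul, Finset.sum_mul]
  refine Finset.sum_congr rfl fun x hx ↦ ?_
  rw [← Finset.HasAntidiagonal.mem_antidiagonal.mp hx, pow_add]
  ring

lemma sub (hP : ConvergesOnDisc P F) (hQ : ConvergesOnDisc Q G) :
    ConvergesOnDisc (P - Q) (F - G) := fun q hq ↦ by
  simpa [sub_mul] using (hP q hq).sub (hQ q hq)

lemma const (c : ℂ) : ConvergesOnDisc (PowerSeries.C c) fun _ ↦ c := fun q _ ↦ by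
  convert! hasSum_single (f := fun n ↦ (PowerSeries.C c).coeff n * q ^ n) 0 ?_ using 1
  · simp
  · intro n hn
    simp [PowerSeries.coeff_C, hn]

lemma pow (hP : ConvergesOnDisc P F) (n : ℕ) : ConvergesOnDisc (P ^ n) (F ^ n) := by
  induction n with
  | zero => simpa using! const 1
  | succ n ih => simpa only [pow_succ] using ih.mul hP

lemma congr (hP : ConvergesOnDisc P F) (h : ∀ q, ‖q‖ < 1 → F q = G q) : ConvergesOnDisc P G :=
  fun q hq ↦ h q hq ▸ hP q hq

lemma X : ConvergesOnDisc PowerSeries.X id := fun q _ ↦ by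
  convert hasSum_single (f := fun n ↦ (PowerSeries.X : PowerSeries ℂ).coeff n * q ^ n) 1 ?_ using 1
  · simp
  · intro n hn
    simp [PowerSeries.coeff_X, hn]

lemma apply_zero (hP : ConvergesOnDisc P F) : F 0 = P.constantCoeff := by
  refine (hP 0 (by simp)).unique ?_
  convert hasSum_single (f := fun n ↦ P.coeff n * (0 : ℂ) ^ n) 0 ?_ using 1
  · simp
  · intro n hn
    simp [hn]

lemma unique (hP : ConvergesOnDisc P F) (hQ : ConvergesOnDisc Q F) : P = Q := by
  have key {R : PowerSeries ℂ} (hR : ConvergesOnDisc R F) :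
      HasFPowerSeriesAt F (.ofScalars ℂ fun n ↦ R.coeff n) 0 := by
    rw [hasFPowerSeriesAt_iff]
    filter_upwards [Metric.ball_mem_nhds (0 : ℂ) one_pos] with q hq
    simpa [FormalMultilinearSeries.coeff_ofScalars, mul_comm] using hR q (by simpa using hq)
  have h := (key hP).eq_formalMultilinearSeries (key hQ)
  ext n
  simpa [FormalMultilinearSeries.coeff_ofScalars] using congrArg (fun p ↦ p.coeff n) h

lemma _root_.DifferentiableOn.exists_convergesOnDisc
    (hF : DifferentiableOn ℂ F (Metric.ball 0 1)) : ∃ P, ConvergesOnDisc P F := by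
  refine ⟨.mk fun n ↦ (n.factorial : ℂ)⁻¹ * iteratedDeriv n F 0, fun q hq ↦ ?_⟩
  convert! Complex.hasSum_taylorSeries_on_ball hF (z := q) (by simpa using hq) using 2 with n
  simp only [PowerSeries.coeff_mk, sub_zero, smul_eq_mul]
  ring

lemma _root_.ModularForm.convergesOnDisc_qExpansion {k : ℤ} (f : ModularForm 𝒮ℒ k) :
    ConvergesOnDisc (qExpansion 1 f) (cuspFunction 1 f) := fun _ hq ↦ by
  have : Fact (IsCusp OnePoint.infty 𝒮ℒ) :=
    ⟨Subgroup.isCusp_of_mem_strictPeriods one_pos one_mem_strictPeriods_SL⟩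
  simpa using UpperHalfPlane.hasSum_qExpansion_of_norm_lt one_pos
    (SlashInvariantFormClass.periodic_comp_ofComplex f one_mem_strictPeriods_SL)
    (ModularFormClass.holo f) (ModularFormClass.bdd_at_infty f) hq

end ConvergesOnDisc

/-- The generating series `∑ σ_k(n) qⁿ`. -/
noncomputable def sigmaSeries (k : ℕ) : PowerSeries ℤ := .mk fun n ↦ (σ k n : ℤ)

lemma PowerSeries.coeff_ofNat_mul {R : Type*} [CommRing R] (n m : ℕ) [m.AtLeastTwo]
    (P : PowerSeries R) :
    coeff n ((OfNat.ofNat m : PowerSeries R) * P) = OfNat.ofNat m * coeff n P := by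
  rw [← map_ofNat (C (R := R)) m, coeff_C_mul]

lemma coeff_one_add_sigmaSeries (n : ℕ) :
    (1 + 240 * sigmaSeries 3).coeff n = (if n = 0 then 1 else 0) + 240 * (σ 3 n : ℤ) := by
  rw [map_add, PowerSeries.coeff_ofNat_mul, PowerSeries.coeff_one, sigmaSeries,
    PowerSeries.coeff_mk]

lemma coeff_one_sub_sigmaSeries (n : ℕ) :
    (1 - 504 * sigmaSeries 5).coeff n = (if n = 0 then 1 else 0) - 504 * (σ 5 n : ℤ) := by
  rw [map_sub, PowerSeries.coeff_ofNat_mul, PowerSeries.coeff_one, sigmaSeries,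
    PowerSeries.coeff_mk]

lemma bernoulli_six : bernoulli 6 = 1 / 42 := by
  rw [bernoulli_eq_bernoulli'_of_ne_one (by norm_num), bernoulli'_def]
  norm_num [Finset.sum_range_succ, Nat.choose, bernoulli'_zero, bernoulli'_one, bernoulli'_two,
    bernoulli'_three, bernoulli'_four, bernoulli'_eq_zero_of_odd (show Odd 5 by decide)]

lemma qExpansion_E₄ : qExpansion 1 E₄ = (1 + 240 * sigmaSeries 3).map (Int.castRingHom ℂ) := by
  ext n
  rw [E_qExpansion_coeff _ ⟨2, rfl⟩, PowerSeries.coeff_map, coeff_one_add_sigmaSeries]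
  rcases eq_or_ne n 0 with rfl | hn
  · simp
  · norm_num [hn, bernoulli_eq_bernoulli'_of_ne_one, bernoulli'_four]

lemma qExpansion_E₆ : qExpansion 1 E₆ = (1 - 504 * sigmaSeries 5).map (Int.castRingHom ℂ) := by
  ext n
  rw [E_qExpansion_coeff _ ⟨3, rfl⟩, PowerSeries.coeff_map, coeff_one_sub_sigmaSeries]
  rcases eq_or_ne n 0 with rfl | hn
  · simp
  · norm_num [hn, bernoulli_six]

lemma twelve_dvd_five_mul_sigma_three_add_seven_mul_sigma_five (n : ℕ) :
    12 ∣ 5 * (σ 3 n : ℤ) + 7 * (σ 5 n : ℤ) := by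
  simp only [ArithmeticFunction.sigma_apply, Nat.cast_sum, Finset.mul_sum,
    ← Finset.sum_add_distrib]
  refine Finset.dvd_sum fun d _ ↦ ?_
  rw [show (12 : ℤ) = (12 : ℕ) from rfl, ← ZMod.intCast_zmod_eq_zero_iff_dvd]
  push_cast
  generalize (d : ZMod 12) = x
  revert x
  decide

/-- The power series of `Δ / q` is integral, and its first coefficients are `1, -24, 252`. -/
lemma exists_series_cube_sub_sq : ∃ D : PowerSeries ℤ,
    (1 + 240 * sigmaSeries 3) ^ 3 - (1 - 504 * sigmaSeries 5) ^ 2 = 1728 * (PowerSeries.X * D) ∧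
      D.coeff 0 = 1 ∧ D.coeff 1 = -24 ∧ D.coeff 2 = 252 := by
  choose t ht using twelve_dvd_five_mul_sigma_three_add_seven_mul_sigma_five
  set A := sigmaSeries 3 with hA
  set B := sigmaSeries 5 with hB
  let T : PowerSeries ℤ := .mk t
  have hT : 5 * A + 7 * B = 12 * T := by
    ext n
    rw [map_add, PowerSeries.coeff_ofNat_mul, PowerSeries.coeff_ofNat_mul,
      PowerSeries.coeff_ofNat_mul]
    simpa [hA, hB, T, sigmaSeries] using ht n
  have t0 : t 0 = 0 := by have := ht 0; simp at this; omega
  have s31 : σ 3 1 = 1 := by decide +kernel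
  have s51 : σ 5 1 = 1 := by decide +kernel
  have s32 : σ 3 2 = 9 := by decide +kernel
  have s52 : σ 5 2 = 33 := by decide +kernel
  have s33 : σ 3 3 = 28 := by decide +kernel
  have s53 : σ 5 3 = 244 := by decide +kernel
  have t1 : t 1 = 1 := by have := ht 1; simp [s31, s51] at this; omega
  have t2 : t 2 = 23 := by have := ht 2; simp [s32, s52] at this; omega
  have t3 : t 3 = 154 := by have := ht 3; simp [s33, s53] at this; omega
  let W := T + 100 * A ^ 2 + 8000 * A ^ 3 - 147 * B ^ 2
  have hW (n : ℕ) : W.coeff n = T.coeff n + 100 * (A ^ 2).coeff n + 8000 * (A ^ 3).coeff n -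
      147 * (B ^ 2).coeff n := by
    simp only [W, map_add, map_sub]
    rw [PowerSeries.coeff_ofNat_mul, PowerSeries.coeff_ofNat_mul, PowerSeries.coeff_ofNat_mul]
  obtain ⟨D, hD⟩ : PowerSeries.X ∣ W := by
    rw [PowerSeries.X_dvd_iff, ← PowerSeries.coeff_zero_eq_constantCoeff_apply, hW]
    simp [T, hA, hB, sigmaSeries, t0, pow_succ, PowerSeries.coeff_mul,
      -PowerSeries.coeff_zero_eq_constantCoeff]
  refine ⟨D, ?_, ?_⟩
  · rw [← hD]
    linear_combination 144 * hT
  · have hc (n : ℕ) : D.coeff n = W.coeff (n + 1) := by rw [hD, PowerSeries.coeff_succ_X_mul]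
    simp only [hc, hW, pow_succ, pow_zero, one_mul, PowerSeries.coeff_mul]
    simp [Finset.Nat.antidiagonal_succ, T, hA, hB, sigmaSeries, t1, t2, t3, s31, s51, s32, s52,
      s33, s53]

lemma exists_series_cube_div : ∃ J D : PowerSeries ℤ,
    (1 + 240 * sigmaSeries 3) ^ 3 - (1 - 504 * sigmaSeries 5) ^ 2 = 1728 * (PowerSeries.X * D) ∧
      J * D = (1 + 240 * sigmaSeries 3) ^ 3 ∧ D ≠ 0 ∧
      J.coeff 0 = 1 ∧ J.coeff 1 = 744 ∧ J.coeff 2 = 196884 := by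
  obtain ⟨D, hD, d0, d1, d2⟩ := exists_series_cube_sub_sq
  obtain ⟨D', hD'⟩ : IsUnit D := by
    rw [PowerSeries.isUnit_iff_constantCoeff, ← PowerSeries.coeff_zero_eq_constantCoeff_apply, d0]
    exact isUnit_one
  have hJ : (1 + 240 * sigmaSeries 3) ^ 3 * (D'⁻¹).val * D = (1 + 240 * sigmaSeries 3) ^ 3 := by
    rw [← hD']
    simp
  refine ⟨_, D, hD, hJ, by rintro rfl; simp at d0, ?_⟩
  generalize (1 + 240 * sigmaSeries 3) ^ 3 * (D'⁻¹).val = J at hJ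
  have hU := coeff_one_add_sigmaSeries
  generalize 1 + 240 * sigmaSeries 3 = U at hJ hU
  have s1 : σ 3 1 = 1 := by decide +kernel
  have s2 : σ 3 2 = 9 := by decide +kernel
  have h (n : ℕ) := congrArg (PowerSeries.coeff n) hJ
  simp only [pow_succ, pow_zero, one_mul, PowerSeries.coeff_mul, hU] at h
  have h0 := h 0
  have h1 := h 1
  have h2 := h 2
  simp [Finset.Nat.antidiagonal_succ, s1, s2, d0, d1, d2,
    -PowerSeries.coeff_zero_eq_constantCoeff] at h0 h1 h2
  simp only [PowerSeries.coeff_zero_eq_constantCoeff] at *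
  omega

lemma eisSum_eq {k : ℕ} (hk : 3 ≤ k) (τ : ℍ) : eisSum k τ = 2 * riemannZeta k * E hk τ := by
  have h := tsum_eisSummand_eq_riemannZeta_mul_eisensteinSeries hk τ
  rw [show E hk τ = (1 / 2 : ℂ) • eisensteinSeriesSIF (N := 1) 0 k τ from rfl,
    eisensteinSeriesSIF_apply 0 k τ, smul_eq_mul]
  have : eisSum k τ = ∑' v, eisSummand k v τ := by
    rw [← (finTwoArrowEquiv ℤ).symm.tsum_eq, eisSum]
    refine (tsum_subtype_eq_of_support_subset
      (f := fun p : ℤ × ℤ ↦ (((p.1 : ℂ) * τ + (p.2 : ℂ)) ^ k)⁻¹) (s := {p | p ≠ 0}) ?_).trans ?_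
    · rintro p hp rfl
      simp [show k ≠ 0 by omega] at hp
    · simp [eisSummand]
  rw [this, h]
  ring

lemma jFun_eq (τ : ℍ) : jFun τ = E₄ τ ^ 3 / discriminant τ := by
  have h4 : riemannZeta (4 : ℕ) = Real.pi ^ 4 / 90 := by exact_mod_cast riemannZeta_four
  have h6 : riemannZeta (6 : ℕ) = Real.pi ^ 6 / 945 := by
    have := riemannZeta_two_mul_nat (k := 3) (by norm_num)
    norm_num [bernoulli_six, Nat.factorial] at this
    norm_num
    rw [this]
    ring
  have hΔ := discriminant_eq_E₄_cube_sub_E₆_sq τ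
  have hne := discriminant_ne_zero τ
  have hpi : (Real.pi : ℂ) ≠ 0 := by exact_mod_cast Real.pi_ne_zero
  rw [jFun, gTwoH, gThreeH, eisSum_eq (k := 4) (by norm_num), eisSum_eq (k := 6) (by norm_num),
    h4, h6]
  have hden : (60 * (2 * (Real.pi ^ 4 / 90) * E₄ τ)) ^ 3 -
      27 * (140 * (2 * (Real.pi ^ 6 / 945) * E₆ τ)) ^ 2 =
      64 / 27 * Real.pi ^ 12 * 1728 * discriminant τ := by
    rw [hΔ]
    ring
  rw [hden]
  field_simp
  ring

lemma exists_convergesOnDisc_cube_div_prod : ∃ J : PowerSeries ℤ,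
    J.coeff 0 = 1 ∧ J.coeff 1 = 744 ∧ J.coeff 2 = 196884 ∧
      ConvergesOnDisc (J.map (Int.castRingHom ℂ))
        fun q ↦ cuspFunction 1 E₄ q ^ 3 / ∏' i, (1 - q ^ (i + 1)) ^ 24 := by
  obtain ⟨J, D, hD, hJ, hD0, h0, h1, h2⟩ := exists_series_cube_div
  refine ⟨J, h0, h1, h2, ?_⟩
  set F : ℂ → ℂ := fun q ↦ cuspFunction 1 E₄ q ^ 3 / ∏' i, (1 - q ^ (i + 1)) ^ 24
  have hprod : ∀ q ∈ Metric.ball (0 : ℂ) 1, ∏' i, (1 - q ^ (i + 1)) ^ 24 ≠ 0 := by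
    intro q hq
    have hm := multipliable_one_sub_pow (q := q) (by simpa using hq)
    rw [hm.tprod_pow]
    refine pow_ne_zero _ ?_
    simp_rw [sub_eq_add_neg]
    refine tprod_one_add_ne_zero_of_summable (fun i h ↦ ?_) ?_
    · have hlt : ‖q ^ (i + 1)‖ < 1 := by
        rw [norm_pow]
        exact pow_lt_one₀ (norm_nonneg _) (by simpa using hq) (by omega)
      rw [← sub_eq_add_neg, sub_eq_zero] at h
      simp [← h] at hlt
    · simpa using (summable_nat_add_iff 1).mpr
        (summable_geometric_of_lt_one (norm_nonneg q) (by simpa using hq))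
  have hdiff : DifferentiableOn ℂ F (Metric.ball 0 1) := by
    refine DifferentiableOn.div (.fun_pow (fun q hq ↦ ?_) 3)
      (differentiableOn_tprod_one_sub_pow_pow 24) hprod
    exact (ModularFormClass.differentiableAt_cuspFunction E₄ one_pos one_mem_strictPeriods_SL
      (by simpa using hq)).differentiableWithinAt
  obtain ⟨H, hH⟩ := hdiff.exists_convergesOnDisc
  have c4 := E₄.convergesOnDisc_qExpansion
  have c6 := E₆.convergesOnDisc_qExpansion
  rw [qExpansion_E₄] at c4
  rw [qExpansion_E₆] at c6
  have h1728 (q : ℂ) (hq : ‖q‖ < 1) : cuspFunction 1 E₄ q ^ 3 - cuspFunction 1 E₆ q ^ 2 =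
      1728 * (q * ∏' i, (1 - q ^ (i + 1)) ^ 24) := by
    rcases eq_or_ne q 0 with rfl | hq0
    · rw [c4.apply_zero, c6.apply_zero, ← PowerSeries.coeff_zero_eq_constantCoeff_apply,
        ← PowerSeries.coeff_zero_eq_constantCoeff_apply, PowerSeries.coeff_map,
        PowerSeries.coeff_map, coeff_one_add_sigmaSeries, coeff_one_sub_sigmaSeries]
      simp
    · have him := Function.Periodic.im_invQParam_pos_of_norm_lt_one one_pos hq hq0
      have hΔ := discriminant_eq_E₄_cube_sub_E₆_sq ⟨_, him⟩
      have hD := discriminant_cuspFunction_eqOn (x := q) (by simpa using hq)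
      dsimp only at hD
      rw [← hD]
      simp only [cuspFunction, Function.Periodic.cuspFunction_eq_of_nonzero 1 _ hq0,
        Function.comp_apply, ofComplex_apply_of_im_pos him, hΔ]
      ring
  have key := (hH.mul ((c4.pow 3).sub (c6.pow 2))).unique
    (((ConvergesOnDisc.const 1728).mul (ConvergesOnDisc.X.mul (c4.pow 3))).congr fun q hq ↦ ?_)
  · rw [← map_pow, ← map_pow, ← map_sub, hD, ← hJ] at key
    have hHJ : H = J.map (Int.castRingHom ℂ) := by
      have hne : PowerSeries.map (Int.castRingHom ℂ) (1728 * (PowerSeries.X * D)) ≠ 0 := by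
        rw [Ne, map_eq_zero_iff _ (PowerSeries.map_injective _ Int.cast_injective)]
        rw [← map_ofNat (PowerSeries.C (R := ℤ)) 1728]
        refine mul_ne_zero ?_ (mul_ne_zero PowerSeries.X_ne_zero hD0)
        rw [Ne, map_eq_zero_iff _ PowerSeries.C_injective]
        norm_num
      refine mul_right_cancel₀ hne (key.trans ?_)
      have h : PowerSeries.map (Int.castRingHom ℂ) 1728 = PowerSeries.C 1728 := by
        rw [map_ofNat, map_ofNat]
      rw [map_mul, map_mul, map_mul, PowerSeries.map_X, h]
      ring
    exact hHJ ▸ hH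
  · have := hprod q (by simpa using hq)
    simp only [Pi.mul_apply, Pi.sub_apply, Pi.pow_apply, h1728 q hq, F, id]
    field_simp

/-- The Fourier expansion of the modular `j`-function in `q = e^{2πiτ}` has integer
coefficients: `j = q⁻¹ + 744 + 196884 q + ⋯ ∈ q⁻¹ + ℤ[[q]]`. -/
theorem jFun_integral_q_expansion :
    ∃ c : ℕ → ℤ, c 0 = 744 ∧ c 1 = 196884 ∧
      ∀ τ : ℍ, jFun τ = (nome τ)⁻¹ + ∑' n : ℕ, (c n : ℂ) * nome τ ^ n := by
  obtain ⟨J, h0, h1, h2, hJ⟩ := exists_convergesOnDisc_cube_div_prod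
  refine ⟨fun n ↦ J.coeff (n + 1), h1, h2, fun τ ↦ ?_⟩
  have hnome : nome τ = Function.Periodic.qParam 1 τ := by simp [nome, Function.Periodic.qParam]
  have hne : nome τ ≠ 0 := Complex.exp_ne_zero _
  have hlt : ‖nome τ‖ < 1 := norm_exp_two_pi_I_lt_one τ
  have hj : jFun τ = (nome τ)⁻¹ *
      (cuspFunction 1 E₄ (nome τ) ^ 3 / ∏' i, (1 - nome τ ^ (i + 1)) ^ 24) := by
    rw [jFun_eq, discriminant_eq_q_prod, hnome,
      SlashInvariantFormClass.eq_cuspFunction E₄ τ one_mem_strictPeriods_SL one_ne_zero]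
    field_simp
  have hs := hJ _ hlt
  dsimp only at hs
  rw [hj, ← hs.tsum_eq, hs.summable.tsum_eq_zero_add, mul_add, ← tsum_mul_left]
  simp only [PowerSeries.coeff_map, h0]
  congr 1
  · simp
  · refine tsum_congr fun n ↦ ?_
    rw [pow_succ]
    field_simp
    simp
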